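/- Let n ≥ 3 and let x be a nilpotent endomorphism of ℂⁿ of Jordan type (n−1, 1), i.e., rank x = n − 2 and x^{n−2} ≠ 0. For 1 ≤ i ≤ n−1 let Lᵢ be the set of complete flags F with x(Fⱼ) ⊆ F_{j−1} for all j, Fⱼ = im(x^{n−1−j}) for 1 ≤ j ≤ i−1, and Fⱼ = ker(x^{j−1}) for i+1 ≤ j ≤ n. Then for 1 ≤ i < i' ≤ n−1, the intersection Lᵢ ∩ L_{i'} is nonempty if and only if i' = i + 1, in which case it consists of exactly one flag, namely the flag with Fⱼ = im(x^{n−1−j}) for j ≤ i and Fⱼ = ker(x^{j−1}) for j ≥ i+1. That is, the n−1 projective lines of the subregular Springer fiber intersect according to the Dynkin diagram of type A_{n−1}. -/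

import Mathlib

/-- `F` is a complete flag `0 = F₀ ⊂ F₁ ⊂ ⋯ ⊂ Fₙ = ℂⁿ` (with `dim Fⱼ = j`). -/
def IsCompleteFlag (n : ℕ) (F : ℕ → Submodule ℂ (Fin n → ℂ)) : Prop :=
  F 0 = ⊥ ∧ F n = ⊤ ∧ (∀ j ≤ n, Module.finrank ℂ (F j) = j) ∧
    ∀ j < n, F j ≤ F (j + 1)

/-- `F` lies in the Springer fiber of `x`: `x(Fⱼ) ⊆ F_{j-1}` for `1 ≤ j ≤ n`. -/
def InSpringerFiber (n : ℕ) (x : Module.End ℂ (Fin n → ℂ))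
    (F : ℕ → Submodule ℂ (Fin n → ℂ)) : Prop :=
  ∀ j, 1 ≤ j → j ≤ n → Submodule.map x (F j) ≤ F (j - 1)

/-- `F` lies in the component `Lᵢ` of the subregular Springer fiber:
`Fⱼ = im(x^{n-1-j})` for `1 ≤ j ≤ i-1` and `Fⱼ = ker(x^{j-1})` for
`i+1 ≤ j ≤ n`. -/
def InLine (n : ℕ) (x : Module.End ℂ (Fin n → ℂ)) (i : ℕ)
    (F : ℕ → Submodule ℂ (Fin n → ℂ)) : Prop :=
  InSpringerFiber n x F ∧
    (∀ j, 1 ≤ j → j ≤ i - 1 → F j = LinearMap.range (x ^ (n - 1 - j))) ∧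
    (∀ j, i + 1 ≤ j → j ≤ n → F j = LinearMap.ker (x ^ (j - 1)))

theorem springer_strict {V : Type*} [AddCommGroup V] [Module ℂ V] [FiniteDimensional ℂ V]
    (x : Module.End ℂ V) (hnil : IsNilpotent x) (k : ℕ) (hk : x ^ k ≠ 0) :
    Module.finrank ℂ (LinearMap.range (x ^ (k + 1))) <
      Module.finrank ℂ (LinearMap.range (x ^ k)) := by
  have hle : ∀ m, LinearMap.range (x ^ (m + 1)) ≤ LinearMap.range (x ^ m) := by
    intro m
    rw [pow_succ, Module.End.mul_eq_comp]
    exact LinearMap.range_comp_le_range _ _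
  apply Submodule.finrank_lt_finrank_of_lt
  refine lt_of_le_of_ne (hle k) ?_
  intro heq
  apply hk
  have hall : ∀ m, LinearMap.range (x ^ (k + m)) = LinearMap.range (x ^ k) := by
    intro m
    induction m with
    | zero => rfl
    | succ m ih =>
      rw [← add_assoc, pow_succ', Module.End.mul_eq_comp, LinearMap.range_comp, ih,
        ← LinearMap.range_comp, ← Module.End.mul_eq_comp, ← pow_succ', heq]
  obtain ⟨N, hN⟩ := hnil
  have h := hall N
  rw [pow_add, hN, mul_zero, LinearMap.range_zero] at h
  exact LinearMap.range_eq_bot.mp h.symm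

theorem springer_range_dim (n : ℕ) (hn : 3 ≤ n) (x : Module.End ℂ (Fin n → ℂ))
    (hnil : IsNilpotent x)
    (hrank : Module.finrank ℂ (LinearMap.range x) = n - 2)
    (hpow : x ^ (n - 2) ≠ 0) (k : ℕ) (hk : 1 ≤ k) (hk' : k ≤ n - 1) :
    Module.finrank ℂ (LinearMap.range (x ^ k)) = n - 1 - k := by
  have hne : ∀ m ≤ n - 2, x ^ m ≠ 0 := fun m hm h => hpow (pow_eq_zero_of_le hm h)
  have hup : ∀ m, m + 1 ≤ n - 1 →
      Module.finrank ℂ (LinearMap.range (x ^ (m + 1))) + (m + 1) ≤ n - 1 := by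
    intro m
    induction m with
    | zero => intro _; rw [zero_add, pow_one, hrank]; omega
    | succ m ih =>
      intro h
      have h1 := ih (by omega)
      have h2 := springer_strict x hnil (m + 1) (hne _ (by omega))
      omega
  have hlow : ∀ m, m ≤ n - 1 →
      m ≤ Module.finrank ℂ (LinearMap.range (x ^ (n - 1 - m))) := by
    intro m
    induction m with
    | zero => intro _; exact Nat.zero_le _
    | succ m ih =>
      intro h
      have h1 := ih (by omega)
      have h2 := springer_strict x hnil (n - 1 - (m + 1)) (hne _ (by omega))
      rw [show n - 1 - (m + 1) + 1 = n - 1 - m by omega] at h2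
      omega
  have h1 := hup (k - 1) (by omega)
  have h2 := hlow (n - 1 - k) (by omega)
  rw [show k - 1 + 1 = k by omega] at h1
  rw [show n - 1 - (n - 1 - k) = k by omega] at h2
  omega

theorem springer_ker_dim (n : ℕ) (hn : 3 ≤ n) (x : Module.End ℂ (Fin n → ℂ))
    (hnil : IsNilpotent x)
    (hrank : Module.finrank ℂ (LinearMap.range x) = n - 2)
    (hpow : x ^ (n - 2) ≠ 0) (k : ℕ) (hk : 1 ≤ k) (hk' : k ≤ n - 1) :
    Module.finrank ℂ (LinearMap.ker (x ^ k)) = k + 1 := by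
  have h1 := springer_range_dim n hn x hnil hrank hpow k hk hk'
  have h2 := LinearMap.finrank_range_add_finrank_ker (x ^ k)
  rw [Module.finrank_fin_fun] at h2
  omega

theorem springer_map_ker (n : ℕ) (hn : 3 ≤ n) (x : Module.End ℂ (Fin n → ℂ))
    (hnil : IsNilpotent x)
    (hrank : Module.finrank ℂ (LinearMap.range x) = n - 2)
    (hpow : x ^ (n - 2) ≠ 0) (hz : x ^ (n - 1) = 0) (i : ℕ) (hi : 1 ≤ i) (hi' : i ≤ n - 2) :
    Submodule.map x (LinearMap.ker (x ^ i)) ≤ LinearMap.range (x ^ (n - 1 - i)) := by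
  have hle : LinearMap.range (x ^ (n - i)) ≤ Submodule.map x (LinearMap.ker (x ^ i)) := by
    rintro _ ⟨z, rfl⟩
    refine ⟨(x ^ (n - 1 - i)) z, ?_, ?_⟩
    · rw [SetLike.mem_coe, LinearMap.mem_ker, ← Module.End.mul_apply, ← pow_add,
        show i + (n - 1 - i) = n - 1 by omega, hz, LinearMap.zero_apply]
    · rw [← Module.End.mul_apply, ← pow_succ', show n - 1 - i + 1 = n - i by omega]
  have hkle : LinearMap.ker x ≤ LinearMap.ker (x ^ i) := by
    intro v hv
    rw [LinearMap.mem_ker] at *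
    rw [show i = i - 1 + 1 by omega, pow_succ, Module.End.mul_apply, hv, map_zero]
  have hk1 := springer_ker_dim n hn x hnil hrank hpow 1 le_rfl (by omega)
  rw [pow_one] at hk1
  have hki := springer_ker_dim n hn x hnil hrank hpow i hi (by omega)
  have hr := springer_range_dim n hn x hnil hrank hpow (n - i) (by omega) (by omega)
  have hrn := LinearMap.finrank_range_add_finrank_ker (x.domRestrict (LinearMap.ker (x ^ i)))
  rw [LinearMap.range_domRestrict, LinearMap.ker_domRestrict,
    (Submodule.comapSubtypeEquivOfLe hkle).finrank_eq, hk1, hki] at hrn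
  have heq := Submodule.eq_of_le_of_finrank_eq hle (by omega)
  rw [← heq, show n - i = n - 1 - i + 1 by omega, pow_succ, Module.End.mul_eq_comp]
  exact LinearMap.range_comp_le_range _ _

/-- The `n-1` projective lines `L₁, …, L_{n-1}` of the subregular Springer
fiber of `sl_n` intersect according to the Dynkin diagram of type `A_{n-1}`:
for `1 ≤ i < i' ≤ n-1`, `Lᵢ ∩ L_{i'} ≠ ∅` iff `i' = i + 1`, in which case the
intersection consists of exactly one flag, namely `Fⱼ = im(x^{n-1-j})` for
`j ≤ i` and `Fⱼ = ker(x^{j-1})` for `j ≥ i + 1`. -/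
theorem subregular_springer_fiber_intersections
    (n : ℕ) (hn : 3 ≤ n) (x : Module.End ℂ (Fin n → ℂ))
    (hnil : IsNilpotent x)
    (hrank : Module.finrank ℂ (LinearMap.range x) = n - 2)
    (hpow : x ^ (n - 2) ≠ 0)
    (i i' : ℕ) (hi : 1 ≤ i) (hii' : i < i') (hi' : i' ≤ n - 1) :
    ((∃ F, IsCompleteFlag n F ∧ InLine n x i F ∧ InLine n x i' F) ↔
      i' = i + 1) ∧
    (i' = i + 1 → ∀ F, IsCompleteFlag n F → InLine n x i F → InLine n x i' F →
      (∀ j, 1 ≤ j → j ≤ i → F j = LinearMap.range (x ^ (n - 1 - j))) ∧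
      (∀ j, i + 1 ≤ j → j ≤ n → F j = LinearMap.ker (x ^ (j - 1)))) := by
  refine ⟨⟨?_, ?_⟩, ?_⟩
  · rintro ⟨F, -, hL, hL'⟩
    by_contra hne
    have h1 := hL.2.2 (i + 1) le_rfl (by omega)
    have h2 := hL'.2.1 (i + 1) (by omega) (by omega)
    rw [h1, Nat.add_sub_cancel] at h2
    apply hpow
    refine LinearMap.ext fun v => ?_
    have h4 : (x ^ (n - 1 - (i + 1))) v ∈ LinearMap.ker (x ^ i) :=
      h2 ▸ LinearMap.mem_range_self _ v
    rw [LinearMap.mem_ker, ← Module.End.mul_apply, ← pow_add] at h4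
    rw [show n - 2 = i + (n - 1 - (i + 1)) by omega, h4, LinearMap.zero_apply]
  · rintro rfl
    have hz : x ^ (n - 1) = 0 := by
      have := springer_range_dim n hn x hnil hrank hpow (n - 1) (by omega) le_rfl
      rw [Nat.sub_self, Submodule.finrank_eq_zero] at this
      exact LinearMap.range_eq_bot.mp this
    have hR : ∀ m, LinearMap.range (x ^ (m + 1)) ≤ LinearMap.range (x ^ m) := by
      intro m
      rw [pow_succ, Module.End.mul_eq_comp]
      exact LinearMap.range_comp_le_range _ _
    have hK : ∀ m, LinearMap.ker (x ^ m) ≤ LinearMap.ker (x ^ (m + 1)) := by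
      intro m
      rw [pow_succ', Module.End.mul_eq_comp]
      exact LinearMap.ker_le_ker_comp _ _
    let F : ℕ → Submodule ℂ (Fin n → ℂ) := fun j =>
      if j = 0 then ⊥ else if j ≤ i then LinearMap.range (x ^ (n - 1 - j))
        else LinearMap.ker (x ^ (j - 1))
    have hF0 : F 0 = ⊥ := rfl
    have hFr : ∀ j, 1 ≤ j → j ≤ i → F j = LinearMap.range (x ^ (n - 1 - j)) := by
      intro j h1 h2
      simp only [F]
      rw [if_neg (by omega), if_pos h2]
    have hFk : ∀ j, i + 1 ≤ j → F j = LinearMap.ker (x ^ (j - 1)) := by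
      intro j h1
      simp only [F]
      rw [if_neg (by omega), if_neg (by omega)]
    have hS : InSpringerFiber n x F := by
      intro j h1 h2
      rcases lt_trichotomy j (i + 1) with h | h | h
      · rw [hFr j h1 (by omega), ← LinearMap.range_comp, ← Module.End.mul_eq_comp, ← pow_succ']
        rcases Nat.eq_or_lt_of_le h1 with h3 | h3
        · subst h3
          rw [show n - 1 - 1 + 1 = n - 1 by omega, hz, LinearMap.range_zero]
          exact bot_le
        · rw [hFr (j - 1) (by omega) (by omega), show n - 1 - (j - 1) = n - 1 - j + 1 by omega]
      · subst h
        rw [hFk _ le_rfl, Nat.add_sub_cancel, hFr i hi le_rfl]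
        exact springer_map_ker n hn x hnil hrank hpow hz i hi (by omega)
      · rw [hFk j (by omega), hFk (j - 1) (by omega)]
        rintro _ ⟨v, hv, rfl⟩
        rw [SetLike.mem_coe, LinearMap.mem_ker] at hv
        rw [LinearMap.mem_ker, ← Module.End.mul_apply, ← pow_succ,
          show j - 1 - 1 + 1 = j - 1 by omega, hv]
    refine ⟨F, ⟨hF0, ?_, ?_, ?_⟩, ⟨hS, ?_, ?_⟩, ⟨hS, ?_, ?_⟩⟩
    · rw [hFk n (by omega), hz, LinearMap.ker_zero]
    · intro j hj
      rcases Nat.eq_zero_or_pos j with h | h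
      · subst h
        rw [hF0, finrank_bot]
      · by_cases h2 : j ≤ i
        · rw [hFr j h h2, springer_range_dim n hn x hnil hrank hpow _ (by omega) (by omega)]
          omega
        · rw [hFk j (by omega), springer_ker_dim n hn x hnil hrank hpow _ (by omega) (by omega)]
          omega
    · intro j hj
      rcases Nat.eq_zero_or_pos j with h | h
      · subst h
        rw [hF0]
        exact bot_le
      · rcases lt_trichotomy j i with h2 | h2 | h2
        · rw [hFr j h (by omega), hFr (j + 1) (by omega) (by omega),
            show n - 1 - j = n - 1 - (j + 1) + 1 by omega]
          exact hR _
        · subst h2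
          rw [hFr j h le_rfl, hFk (j + 1) le_rfl]
          rintro _ ⟨v, rfl⟩
          rw [LinearMap.mem_ker, ← Module.End.mul_apply, ← pow_add,
            show j + 1 - 1 + (n - 1 - j) = n - 1 by omega, hz, LinearMap.zero_apply]
        · rw [hFk j (by omega), hFk (j + 1) (by omega),
            show j + 1 - 1 = j - 1 + 1 by omega]
          exact hK _
    · exact fun j h1 h2 => hFr j h1 (by omega)
    · exact fun j h1 _ => hFk j h1
    · exact fun j h1 h2 => hFr j h1 (by omega)
    · exact fun j h1 _ => hFk j (by omega)
  · rintro rfl F - hL hL'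
    exact ⟨fun j h1 h2 => hL'.2.1 j h1 (by omega), hL.2.2⟩
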